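/- Let A be an infinite set, p ∉ A, X = A ∪ {p}, with topology τ = {∅, A, X}. Then the set (X × X) \ (A × A) is an infinite nowhere dense subset of the product space X × X; hence X × X is not a C₂-space (and in particular not sg-compact), although X is sg-compact. Thus the product of two sg-compact spaces need not be sg-compact, nor even a C₂-space. -/

import Mathlib

open Set TopologicalSpace

/-- A set is semi-open if it is contained in the closure of its interior. -/
def SemiOpen {X : Type*} [TopologicalSpace X] (A : Set X) : Prop :=
  A ⊆ closure (interior A)

/-- A set is semi-closed if the interior of its closure is contained in it. -/
def SemiClosed {X : Type*} [TopologicalSpace X] (A : Set X) : Prop :=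
  interior (closure A) ⊆ A

/-- The semi-closure of a set: intersection of all semi-closed supersets. -/
def sCl {X : Type*} [TopologicalSpace X] (A : Set X) : Set X :=
  ⋂₀ {B | SemiClosed B ∧ A ⊆ B}

/-- A set is sg-closed if its semi-closure is contained in every semi-open superset. -/
def SgClosed {X : Type*} [TopologicalSpace X] (A : Set X) : Prop :=
  ∀ U : Set X, SemiOpen U → A ⊆ U → sCl A ⊆ U

/-- A set is sg-open if its complement is sg-closed. -/
def SgOpen {X : Type*} [TopologicalSpace X] (A : Set X) : Prop :=
  SgClosed Aᶜ

/-- A set is hereditarily sg-closed if every subset of it is sg-closed. -/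
def HSgClosed {X : Type*} [TopologicalSpace X] (A : Set X) : Prop :=
  ∀ B ⊆ A, SgClosed B

/-- A space is sg-compact if every cover by sg-open sets has a finite subcover. -/
def SgCompact (X : Type*) [TopologicalSpace X] : Prop :=
  ∀ 𝒰 : Set (Set X), (∀ U ∈ 𝒰, SgOpen U) → ⋃₀ 𝒰 = univ →
    ∃ ℱ ⊆ 𝒰, ℱ.Finite ∧ ⋃₀ ℱ = univ

/-- A space is semi-compact if every cover by semi-open sets has a finite subcover. -/
def SemiCompact (X : Type*) [TopologicalSpace X] : Prop :=
  ∀ 𝒰 : Set (Set X), (∀ U ∈ 𝒰, SemiOpen U) → ⋃₀ 𝒰 = univ →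
    ∃ ℱ ⊆ 𝒰, ℱ.Finite ∧ ⋃₀ ℱ = univ

/-- A C₂-space: every nowhere dense subset is finite. -/
def C2Space (X : Type*) [TopologicalSpace X] : Prop :=
  ∀ A : Set X, interior (closure A) = ∅ → A.Finite

/-- A C₃-space: every hereditarily sg-closed subset is finite. -/
def C3Space (X : Type*) [TopologicalSpace X] : Prop :=
  ∀ A : Set X, HSgClosed A → A.Finite

/-- A set is regular open if it equals the interior of its closure. -/
def RegularOpen {X : Type*} [TopologicalSpace X] (A : Set X) : Prop :=
  A = interior (closure A)

/-- A set is δ-open if it is a union of regular open sets. -/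
def DeltaOpen {X : Type*} [TopologicalSpace X] (A : Set X) : Prop :=
  ∃ 𝒞 : Set (Set X), (∀ R ∈ 𝒞, RegularOpen R) ∧ A = ⋃₀ 𝒞

theorem SemiClosed.sgClosed {X : Type*} [TopologicalSpace X] {A : Set X} (hA : SemiClosed A) :
    SgClosed A :=
  fun _ _ hAU _ hx => hAU (hx A ⟨hA, subset_rfl⟩)

theorem semiClosed_of_interior_closure_eq_empty {X : Type*} [TopologicalSpace X] {A : Set X}
    (hA : interior (closure A) = ∅) : SemiClosed A := by
  simp [SemiClosed, hA]

theorem SgCompact.c2Space {X : Type*} [TopologicalSpace X] (h : SgCompact X) : C2Space X := by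
  intro N hN
  rcases N.eq_empty_or_nonempty with rfl | ⟨a, ha⟩
  · exact finite_empty
  let f : X → Set X := fun x => (N \ {x})ᶜ
  have hsg : ∀ U ∈ f '' N, SgOpen U := by
    rintro _ ⟨x, -, rfl⟩
    rw [SgOpen, compl_compl]
    exact (semiClosed_of_interior_closure_eq_empty
      (subset_empty_iff.1 ((interior_mono (closure_mono sdiff_subset)).trans hN.subset))).sgClosed
  have hcover : ⋃₀ (f '' N) = univ := by
    refine eq_univ_of_forall fun x => ?_
    by_cases hx : x ∈ N
    · exact ⟨f x, mem_image_of_mem f hx, fun hx' => hx'.2 rfl⟩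
    · exact ⟨f a, mem_image_of_mem f ha, fun hx' => hx hx'.1⟩
  obtain ⟨t, -, ht, hcov⟩ := exists_subset_image_finite_and.1 (h (f '' N) hsg hcover)
  refine ht.subset fun x hx => ?_
  obtain ⟨_, ⟨y, hy, rfl⟩, hxy⟩ := mem_sUnion.1 (hcov.ge (mem_univ x))
  have : x = y := by by_contra hne; exact hxy ⟨hx, hne⟩
  exact this ▸ hy

/-- For `X = A ∪ {p}` with `A` infinite, `p ∉ A` and topology
`{∅, A, X}`, the set `(X × X) \ (A × A)` is an infinite nowhere dense subset of
the product `X × X`; hence `X × X` is not a C₂-space and not sg-compact, even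
though `X` is sg-compact. -/
theorem stmt_17 {X : Type*} [TopologicalSpace X] (A : Set X) (p : X)
    (hp : p ∉ A) (hA : A.Infinite) (hU : A ∪ {p} = univ)
    (ht : ∀ s : Set X, IsOpen s ↔ s = ∅ ∨ s = A ∨ s = univ) :
    ((A ×ˢ A : Set (X × X))ᶜ).Infinite ∧
    interior (closure ((A ×ˢ A : Set (X × X))ᶜ)) = ∅ ∧
    ¬ C2Space (X × X) ∧ ¬ SgCompact (X × X) ∧ SgCompact X := by
  have hAo : IsOpen A := (ht A).2 (.inr (.inl rfl))
  have hmeet {s : Set X} (hs : (s ∩ A).Nonempty) : Dense s := by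
    refine dense_iff_inter_open.2 fun U hUo hUne => ?_
    rcases (ht U).1 hUo with rfl | rfl | rfl
    · exact absurd hUne not_nonempty_empty
    · rwa [inter_comm]
    · rw [univ_inter]
      exact hs.mono inter_subset_left
  have hAd : Dense A := hmeet (by rw [inter_self]; exact hA.nonempty)
  have hinf : ((A ×ˢ A : Set (X × X))ᶜ).Infinite := by
    refine (hA.image (f := fun a => (a, p)) fun _ _ _ _ h => (Prod.ext_iff.1 h).1).mono ?_
    rintro _ ⟨a, -, rfl⟩ h
    exact hp h.2
  have hnd : interior (closure ((A ×ˢ A : Set (X × X))ᶜ)) = ∅ := by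
    rw [(hAo.prod hAo).isClosed_compl.closure_eq, interior_compl, (hAd.prod hAd).closure_eq,
      compl_univ]
  have hC2 : ¬ C2Space (X × X) := fun h => hinf (h _ hnd)
  refine ⟨hinf, hnd, hC2, fun h => hC2 h.c2Space, fun 𝒰 h𝒰 hcov => ?_⟩
  obtain ⟨U, hU𝒰, hpU⟩ := mem_sUnion.1 (hcov.ge (mem_univ p))
  have hUA : Uᶜ ⊆ A := fun x hx =>
    (hU.ge (mem_univ x)).resolve_right fun h => hx (mem_singleton_iff.1 h ▸ hpU)
  have hUuniv : U = univ := by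
    refine eq_univ_of_forall fun x => by_contra fun hx => hp ?_
    refine h𝒰 U hU𝒰 A (by rw [SemiOpen, hAo.interior_eq]; exact subset_closure) hUA ?_
    rintro B ⟨hB, hUB⟩
    have hBd : Dense B := hmeet ⟨x, hUB hx, hUA hx⟩
    rw [SemiClosed, hBd.closure_eq, interior_univ] at hB
    exact hB (mem_univ p)
  exact ⟨{U}, singleton_subset_iff.2 hU𝒰, finite_singleton U, by rw [sUnion_singleton, hUuniv]⟩
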